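/- arXiv:2210.14103 — 2 statements merged into one kernel-verified Lean document; each statement's English description precedes it below -/
import Mathlib

section
/- Let b be a {0,1}-valued random variable and Y a random variable taking values in a finite set 𝒴, defined on a common finite probability space, with P(Y = y) > 0 for all y ∈ 𝒴. For a random variable Z taking finitely many values, define the mutual information I(b; Z) = Σ_{β∈{0,1}} Σ_{z} P(b = β, Z = z) · log( P(b = β, Z = z) / (P(b = β) · P(Z = z)) ), where the sum runs over z with P(Z = z) > 0 and terms with P(b = β, Z = z) = 0 are taken to be 0. Define t : 𝒴 → [0,1] by t(y) = P(b = 1 | Y = y). Then I(b; t(Y)) = I(b; Y). -/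
/-- Mutual information `I(b; Z)` between a Bool-valued random variable `bv` and a discrete
random variable `Z` on a finite probability space with weights `w`: the sum over `β` and
over values `z` in the range of `Z` of `P(b=β, Z=z) · log(P(b=β, Z=z)/(P(b=β)·P(Z=z)))`,
with terms where the joint probability is `0` taken to be `0` (values `z` outside the range
of `Z` have zero joint probability, hence contribute `0`). -/
noncomputable def binMI {Ω γ : Type*} [Fintype Ω] [DecidableEq γ]
    (w : Ω → ℝ) (bv : Ω → Bool) (Z : Ω → γ) : ℝ :=
  ∑ β : Bool, ∑ z ∈ Finset.univ.image Z,
    (if (∑ ω ∈ Finset.univ.filter (fun ω => bv ω = β ∧ Z ω = z), w ω) = 0 then 0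
     else (∑ ω ∈ Finset.univ.filter (fun ω => bv ω = β ∧ Z ω = z), w ω) *
       Real.log ((∑ ω ∈ Finset.univ.filter (fun ω => bv ω = β ∧ Z ω = z), w ω) /
         ((∑ ω ∈ Finset.univ.filter (fun ω => bv ω = β), w ω) *
          (∑ ω ∈ Finset.univ.filter (fun ω => Z ω = z), w ω))))

open Finset in
/-- If the joint weights of `(bv, Z)` factor as `c β z` times the marginal of `Z`, then the mutual
information is the expectation of `log (c / P(b))`. -/
theorem binMI_eq_sum_mul_log {Ω γ : Type*} [Fintype Ω] [DecidableEq γ]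
    (w : Ω → ℝ) (bv : Ω → Bool) (Z : Ω → γ) (c : Bool → γ → ℝ)
    (hc : ∀ β z, ∑ ω ∈ univ.filter (fun ω => bv ω = β ∧ Z ω = z), w ω =
      c β z * ∑ ω ∈ univ.filter (fun ω => Z ω = z), w ω) :
    binMI w bv Z = ∑ ω, w ω *
      Real.log (c (bv ω) (Z ω) / ∑ ω' ∈ univ.filter (fun ω' => bv ω' = bv ω), w ω') := by
  refine Eq.trans ?_ (sum_fiberwise univ bv _)
  refine sum_congr rfl fun β _ => ?_
  refine Eq.trans ?_ (sum_fiberwise_of_maps_to (t := univ.image Z)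
    (fun ω _ => mem_image_of_mem Z (mem_univ ω)) _)
  refine sum_congr rfl fun z _ => ?_
  have hlog : ∑ ω ∈ (univ.filter (fun ω => bv ω = β)).filter (fun ω => Z ω = z), w ω *
      Real.log (c (bv ω) (Z ω) / ∑ ω' ∈ univ.filter (fun ω' => bv ω' = bv ω), w ω') =
      (∑ ω ∈ univ.filter (fun ω => bv ω = β ∧ Z ω = z), w ω) *
        Real.log (c β z / ∑ ω' ∈ univ.filter (fun ω' => bv ω' = β), w ω') := by
    rw [filter_filter, sum_mul]
    refine sum_congr rfl fun ω hω => ?_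
    obtain ⟨rfl, rfl⟩ := (mem_filter.mp hω).2
    rfl
  rw [hlog]
  split_ifs with h
  · rw [h, zero_mul]
  · have hq : ∑ ω ∈ univ.filter (fun ω => Z ω = z), w ω ≠ 0 := by
      intro hq
      exact h (by rw [hc, hq, mul_zero])
    congr 2
    rw [hc, mul_div_mul_right _ _ hq]

open Finset in
/-- A factorization of the joint weights of `(bv, Y)` through `f ∘ Y` passes to `(bv, f ∘ Y)`. -/
theorem sum_filter_comp_eq_mul {Ω α γ : Type*} [Fintype Ω] [Fintype α] [DecidableEq α]
    [DecidableEq γ] (w : Ω → ℝ) (bv : Ω → Bool) (Y : Ω → α) (f : α → γ) (c : Bool → γ → ℝ)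
    (hc : ∀ β y, ∑ ω ∈ univ.filter (fun ω => bv ω = β ∧ Y ω = y), w ω =
      c β (f y) * ∑ ω ∈ univ.filter (fun ω => Y ω = y), w ω) (β : Bool) (z : γ) :
    ∑ ω ∈ univ.filter (fun ω => bv ω = β ∧ f (Y ω) = z), w ω =
      c β z * ∑ ω ∈ univ.filter (fun ω => f (Y ω) = z), w ω := by
  rw [← sum_fiberwise (s := univ.filter (fun ω => bv ω = β ∧ f (Y ω) = z)) (g := Y),
    ← sum_fiberwise (s := univ.filter (fun ω => f (Y ω) = z)) (g := Y), mul_sum]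
  refine sum_congr rfl fun y _ => ?_
  rw [filter_filter, filter_filter]
  by_cases hy : f y = z
  · subst hy
    convert hc β y using 3 <;> grind
  · rw [filter_false_of_mem (by grind), filter_false_of_mem (by grind), sum_empty, mul_zero]

/-- For the posterior map `t y = P(b = 1 | Y = y)` on a finite probability
space, the mutual information satisfies `I(b; t(Y)) = I(b; Y)`. -/
theorem mi_of_posterior_statistic_eq_mi
    {Ω 𝒴 : Type*} [Fintype Ω] [Fintype 𝒴] [DecidableEq 𝒴]
    (w : Ω → ℝ) (hw : ∀ ω, 0 ≤ w ω) (hw1 : ∑ ω, w ω = 1)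
    (bv : Ω → Bool) (Yr : Ω → 𝒴)
    (hY : ∀ y : 𝒴, 0 < ∑ ω ∈ Finset.univ.filter (fun ω => Yr ω = y), w ω)
    (t : 𝒴 → ℝ)
    (ht : ∀ y, t y =
      (∑ ω ∈ Finset.univ.filter (fun ω => Yr ω = y ∧ bv ω = true), w ω) /
        (∑ ω ∈ Finset.univ.filter (fun ω => Yr ω = y), w ω)) :
    binMI w bv (fun ω => t (Yr ω)) = binMI w bv Yr := by
  have hc : ∀ β y, ∑ ω ∈ Finset.univ.filter (fun ω => bv ω = β ∧ Yr ω = y), w ω =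
      (if β then t y else 1 - t y) * ∑ ω ∈ Finset.univ.filter (fun ω => Yr ω = y), w ω := by
    intro β y
    have htrue : ∑ ω ∈ Finset.univ.filter (fun ω => bv ω = true ∧ Yr ω = y), w ω =
        t y * ∑ ω ∈ Finset.univ.filter (fun ω => Yr ω = y), w ω := by
      rw [ht, div_mul_cancel₀ _ (hY y).ne']
      simp only [and_comm]
    have hadd := Finset.sum_fiberwise (Finset.univ.filter (fun ω => Yr ω = y)) bv w
    simp only [Fintype.sum_bool, Finset.filter_filter, and_comm (a := Yr _ = y)] at hadd
    cases β
    · simp only [Bool.false_eq_true, if_false]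
      linarith
    · simpa using htrue
  rw [binMI_eq_sum_mul_log w bv Yr (fun β y => if β then t y else 1 - t y) hc,
    binMI_eq_sum_mul_log w bv (fun ω => t (Yr ω)) (fun β s => if β then s else 1 - s)
      (sum_filter_comp_eq_mul w bv Yr t (fun β s => if β then s else 1 - s) hc)]
end

section
/- Let B = (b₁,…,b_K) be a {0,1}^K-valued random vector and Y a random variable taking values in a finite set 𝒴, defined on a common finite probability space, with P(Y = y) > 0 for all y ∈ 𝒴. Define t_k : 𝒴 → [0,1] by t_k(y) = P(b_k = 1 | Y = y) for k = 1,…,K. Then the bitwise mutual information satisfies Σ_{k=1}^K I(b_k; t_k(Y)) = Σ_{k=1}^K I(b_k; Y), and for every K-tuple of functions f = (f₁,…,f_K) with f_k : 𝒴 → [0,1], Σ_{k=1}^K I(b_k; f_k(Y)) ≤ Σ_{k=1}^K I(b_k; Y). Hence the posterior marginals (t₁,…,t_K) maximize the bitwise mutual information Σ_{k=1}^K I(b_k; f_k(Y)) over all such f. -/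
open Finset in
/-- Grouping a sum over `Ω` by the values of a pair of random variables. -/
theorem sum_joint_mass_mul {Ω γ : Type*} [Fintype Ω] [DecidableEq γ]
    (w : Ω → ℝ) (b : Ω → Bool) (Z : Ω → γ) (F : Bool → γ → ℝ) :
    ∑ β : Bool, ∑ z ∈ univ.image Z, (∑ ω ∈ univ.filter (fun ω => b ω = β ∧ Z ω = z), w ω) * F β z =
      ∑ ω, w ω * F (b ω) (Z ω) := by
  rw [← sum_fiberwise univ b]
  refine sum_congr rfl fun β _ => ?_
  rw [← sum_fiberwise_of_maps_to (t := univ.image Z) (g := Z)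
    (fun ω _ => mem_image_of_mem Z (mem_univ ω))]
  refine sum_congr rfl fun z _ => ?_
  rw [sum_mul, filter_filter]
  refine sum_congr rfl fun ω hω => ?_
  obtain ⟨h₁, h₂⟩ := (mem_filter.1 hω).2
  rw [h₁, h₂]

open Finset in
/-- Mutual information is the expected log-likelihood ratio. -/
theorem binMI_eq_sum {Ω γ : Type*} [Fintype Ω] [DecidableEq γ]
    (w : Ω → ℝ) (b : Ω → Bool) (Z : Ω → γ) :
    binMI w b Z = ∑ ω, w ω * Real.log
      ((∑ ω' ∈ univ.filter (fun ω' => b ω' = b ω ∧ Z ω' = Z ω), w ω') /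
        ((∑ ω' ∈ univ.filter (fun ω' => b ω' = b ω), w ω') *
          (∑ ω' ∈ univ.filter (fun ω' => Z ω' = Z ω), w ω'))) := by
  rw [← sum_joint_mass_mul w b Z (fun β z => Real.log
      ((∑ ω' ∈ univ.filter (fun ω' => b ω' = β ∧ Z ω' = z), w ω') /
        ((∑ ω' ∈ univ.filter (fun ω' => b ω' = β), w ω') *
          (∑ ω' ∈ univ.filter (fun ω' => Z ω' = z), w ω'))))]
  refine sum_congr rfl fun β _ => sum_congr rfl fun z _ => ?_
  split_ifs with h
  · rw [h, zero_mul]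
  · rfl

open Finset in
theorem mass_pos_of_mem {Ω : Type*} [Fintype Ω] {w : Ω → ℝ} (hw : ∀ ω, 0 ≤ w ω)
    {p : Ω → Prop} [DecidablePred p] {ω : Ω} (hω : 0 < w ω) (hp : p ω) :
    0 < ∑ ω' ∈ univ.filter p, w ω' :=
  sum_pos' (fun i _ => hw i) ⟨ω, by simp [hp], hω⟩

open Finset in
/-- The joint masses of a pair of random variables sum to the mass of the second one. -/
theorem sum_joint_mass {Ω γ : Type*} [Fintype Ω] [DecidableEq γ]
    (w : Ω → ℝ) (b : Ω → Bool) (Z : Ω → γ) (z : γ) :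
    ∑ β : Bool, ∑ ω ∈ univ.filter (fun ω => b ω = β ∧ Z ω = z), w ω =
      ∑ ω ∈ univ.filter (fun ω => Z ω = z), w ω := by
  rw [← sum_fiberwise (univ.filter (fun ω => Z ω = z)) b]
  simp only [filter_filter, and_comm]

open Finset in
/-- Data processing inequality for deterministic functions. -/
theorem binMI_comp_le {Ω γ δ : Type*} [Fintype Ω] [DecidableEq γ] [DecidableEq δ]
    {w : Ω → ℝ} (hw : ∀ ω, 0 ≤ w ω) (b : Ω → Bool) (Z : Ω → γ) (g : γ → δ) :
    binMI w b (fun ω => g (Z ω)) ≤ binMI w b Z := by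
  set J : Bool → γ → ℝ := fun β z => ∑ ω ∈ univ.filter (fun ω => b ω = β ∧ Z ω = z), w ω
  set P : γ → ℝ := fun z => ∑ ω ∈ univ.filter (fun ω => Z ω = z), w ω
  set J' : Bool → δ → ℝ :=
    fun β c => ∑ ω ∈ univ.filter (fun ω => b ω = β ∧ g (Z ω) = c), w ω
  set P' : δ → ℝ := fun c => ∑ ω ∈ univ.filter (fun ω => g (Z ω) = c), w ω
  have hJ0 : ∀ β z, 0 ≤ J β z := fun β z => sum_nonneg fun i _ => hw i
  have hP0 : ∀ z, 0 ≤ P z := fun z => sum_nonneg fun i _ => hw i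
  have hJ'0 : ∀ β c, 0 ≤ J' β c := fun β c => sum_nonneg fun i _ => hw i
  have hP'0 : ∀ c, 0 ≤ P' c := fun c => sum_nonneg fun i _ => hw i
  have ratio_sum_le : ∑ ω, w ω * (J' (b ω) (g (Z ω)) * P (Z ω) /
      (J (b ω) (Z ω) * P' (g (Z ω)))) ≤ ∑ ω, w ω := by
    rw [← sum_joint_mass_mul w b Z (fun β z => J' β (g z) * P z / (J β z * P' (g z))), sum_comm,
      ← sum_fiberwise_of_maps_to (s := univ) (t := univ.image Z) (g := Z)
        (fun ω _ => mem_image_of_mem Z (mem_univ ω)) w]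
    refine sum_le_sum fun z _ => ?_
    calc ∑ β, J β z * (J' β (g z) * P z / (J β z * P' (g z)))
        ≤ ∑ β, J' β (g z) * (P z / P' (g z)) := by
          refine sum_le_sum fun β _ => ?_
          rcases (hJ0 β z).eq_or_lt with h | h
          · rw [← h, zero_mul]
            exact mul_nonneg (hJ'0 _ _) (div_nonneg (hP0 _) (hP'0 _))
          · rw [mul_div_mul_comm, ← mul_assoc, mul_div_cancel₀ _ h.ne']
      _ = P' (g z) * (P z / P' (g z)) := by
          rw [← sum_mul, sum_joint_mass w b (fun ω => g (Z ω)) (g z)]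
      _ ≤ P z := by
          rcases (hP'0 (g z)).eq_or_lt with h | h
          · rw [← h, zero_mul]
            exact hP0 z
          · rw [mul_div_cancel₀ _ h.ne']
  rw [← sub_nonpos, ← sum_sub_distrib] at ratio_sum_le
  rw [binMI_eq_sum, binMI_eq_sum, ← sub_nonpos, ← sum_sub_distrib]
  refine (sum_le_sum fun ω _ => ?_).trans ratio_sum_le
  rcases (hw ω).eq_or_lt with h | h
  · simp [← h]
  have h₁ : 0 < J (b ω) (Z ω) := mass_pos_of_mem hw h ⟨rfl, rfl⟩
  have h₂ : 0 < P (Z ω) := mass_pos_of_mem hw h rfl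
  have h₃ : 0 < J' (b ω) (g (Z ω)) := mass_pos_of_mem hw h ⟨rfl, rfl⟩
  have h₄ : 0 < P' (g (Z ω)) := mass_pos_of_mem hw h rfl
  have h₅ : 0 < ∑ ω' ∈ univ.filter (fun ω' => b ω' = b ω), w ω' := mass_pos_of_mem hw h rfl
  rw [← mul_sub, ← mul_sub_one]
  refine mul_le_mul_of_nonneg_left ?_ h.le
  rw [← Real.log_div (by positivity) (by positivity)]
  refine (le_of_eq ?_).trans (Real.log_le_sub_one_of_pos (by positivity))
  congr 1
  change J' (b ω) (g (Z ω)) / (_ * P' (g (Z ω))) / (J (b ω) (Z ω) / (_ * P (Z ω))) = _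
  field_simp

open Finset in
/-- A function of `Z` through which the conditional law of `b` given `Z` factors is sufficient:
it has the same mutual information with `b` as `Z`. -/
theorem binMI_comp_eq_of_sufficient {Ω γ δ : Type*} [Fintype Ω] [DecidableEq γ] [DecidableEq δ]
    {w : Ω → ℝ} (hw : ∀ ω, 0 ≤ w ω) (b : Ω → Bool) (Z : Ω → γ) (g : γ → δ) (r : Bool → δ → ℝ)
    (hr : ∀ β z, ∑ ω ∈ univ.filter (fun ω => b ω = β ∧ Z ω = z), w ω =
      r β (g z) * ∑ ω ∈ univ.filter (fun ω => Z ω = z), w ω) :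
    binMI w b (fun ω => g (Z ω)) = binMI w b Z := by
  have hr' : ∀ β c, ∑ ω ∈ univ.filter (fun ω => b ω = β ∧ g (Z ω) = c), w ω =
      r β c * ∑ ω ∈ univ.filter (fun ω => g (Z ω) = c), w ω := by
    intro β c
    rw [← sum_fiberwise_of_maps_to (t := univ.image Z) (g := Z)
        (fun ω _ => mem_image_of_mem Z (mem_univ ω)),
      ← sum_fiberwise_of_maps_to (s := univ.filter (fun ω => g (Z ω) = c)) (t := univ.image Z)
        (g := Z) (fun ω _ => mem_image_of_mem Z (mem_univ ω)), mul_sum]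
    refine sum_congr rfl fun z _ => ?_
    simp only [filter_filter]
    by_cases hz : g z = c
    · have h₁ : ∀ ω, ((b ω = β ∧ g (Z ω) = c) ∧ Z ω = z) ↔ (b ω = β ∧ Z ω = z) := by grind
      have h₂ : ∀ ω, (g (Z ω) = c ∧ Z ω = z) ↔ Z ω = z := by grind
      simp only [h₁, h₂, hr, hz]
    · have h₁ : ∀ ω, ¬ ((b ω = β ∧ g (Z ω) = c) ∧ Z ω = z) := by grind
      have h₂ : ∀ ω, ¬ (g (Z ω) = c ∧ Z ω = z) := by grind
      simp [h₁, h₂]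
  rw [binMI_eq_sum, binMI_eq_sum]
  refine sum_congr rfl fun ω _ => ?_
  rcases (hw ω).eq_or_lt with h | h
  · simp [← h]
  have h₁ : 0 < ∑ ω' ∈ univ.filter (fun ω' => Z ω' = Z ω), w ω' := mass_pos_of_mem hw h rfl
  have h₂ : 0 < ∑ ω' ∈ univ.filter (fun ω' => g (Z ω') = g (Z ω)), w ω' :=
    mass_pos_of_mem hw h rfl
  rw [hr, hr', mul_div_mul_right _ _ h₁.ne', mul_div_mul_right _ _ h₂.ne']

/-- The posterior marginals `t k y = P(b_k = 1 | Y = y)` achieve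
`∑ₖ I(b_k; t_k(Y)) = ∑ₖ I(b_k; Y)`, and every `f = (f₁,…,f_K)` with `f_k : 𝒴 → [0,1]`
satisfies `∑ₖ I(b_k; f_k(Y)) ≤ ∑ₖ I(b_k; Y)`; hence the posterior marginals maximize
the bitwise mutual information. -/
theorem posterior_marginals_maximize_bitwise_mi
    {Ω 𝒴 : Type*} [Fintype Ω] [Fintype 𝒴] [DecidableEq 𝒴]
    (K : ℕ) (hK : 1 ≤ K)
    (w : Ω → ℝ) (hw : ∀ ω, 0 ≤ w ω) (hw1 : ∑ ω, w ω = 1)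
    (B : Ω → Fin K → Bool) (Yr : Ω → 𝒴)
    (hY : ∀ y : 𝒴, 0 < ∑ ω ∈ Finset.univ.filter (fun ω => Yr ω = y), w ω)
    (t : Fin K → 𝒴 → ℝ)
    (ht : ∀ k y, t k y =
      (∑ ω ∈ Finset.univ.filter (fun ω => Yr ω = y ∧ B ω k = true), w ω) /
        (∑ ω ∈ Finset.univ.filter (fun ω => Yr ω = y), w ω)) :
    (∑ k : Fin K, binMI w (fun ω => B ω k) (fun ω => t k (Yr ω))) =
      (∑ k : Fin K, binMI w (fun ω => B ω k) Yr) ∧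
    ∀ f : Fin K → 𝒴 → ℝ, (∀ k y, 0 ≤ f k y ∧ f k y ≤ 1) →
      (∑ k : Fin K, binMI w (fun ω => B ω k) (fun ω => f k (Yr ω))) ≤
        (∑ k : Fin K, binMI w (fun ω => B ω k) Yr) ∧
      (∑ k : Fin K, binMI w (fun ω => B ω k) (fun ω => f k (Yr ω))) ≤
        (∑ k : Fin K, binMI w (fun ω => B ω k) (fun ω => t k (Yr ω))) := by
  have key : (∑ k : Fin K, binMI w (fun ω => B ω k) (fun ω => t k (Yr ω))) =
      ∑ k : Fin K, binMI w (fun ω => B ω k) Yr := by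
    refine Finset.sum_congr rfl fun k _ => ?_
    refine binMI_comp_eq_of_sufficient hw (fun ω => B ω k) Yr (t k)
      (fun β c => if β then c else 1 - c) fun β y => ?_
    have h_true : ∑ ω ∈ Finset.univ.filter (fun ω => B ω k = true ∧ Yr ω = y), w ω =
        t k y * ∑ ω ∈ Finset.univ.filter (fun ω => Yr ω = y), w ω := by
      rw [ht, div_mul_cancel₀ _ (hY y).ne']
      simp only [and_comm]
    cases β
    · have h_sum := sum_joint_mass w (fun ω => B ω k) Yr y
      rw [Fintype.sum_bool] at h_sum
      simp only [Bool.false_eq_true, if_false]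
      linarith
    · simpa using h_true
  have data_processing : ∀ f : Fin K → 𝒴 → ℝ,
      (∑ k : Fin K, binMI w (fun ω => B ω k) (fun ω => f k (Yr ω))) ≤
        ∑ k : Fin K, binMI w (fun ω => B ω k) Yr :=
    fun f => Finset.sum_le_sum fun k _ => binMI_comp_le hw (fun ω => B ω k) Yr (f k)
  exact ⟨key, fun f _ => ⟨data_processing f, key ▸ data_processing f⟩⟩
end
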